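/- Suppose that for every AD-compact space K of weight at most 𝔠, the Banach space C(K) embeds isomorphically into ℓ∞/c₀. Then for every binary relation E ⊆ ℝ² and for all but finitely many positive integers n, the set E^[n] can be separated from (E^c)^[n] by a member of 𝒫ⁿ(ℝ). -/

import Mathlib

open Filter Topology Set MeasureTheory

noncomputable section

/-- `ℓ∞`: the Banach space of bounded real sequences with the sup norm. -/
abbrev Linf : Type := lp (fun _ : ℕ => ℝ) ⊤

/-- `c₀`: the subspace of `ℓ∞` of sequences converging to `0`. -/
def c0 : Submodule ℝ Linf where
  carrier := {x | Filter.Tendsto (fun n => (x : ∀ _ : ℕ, ℝ) n) Filter.atTop (nhds (0 : ℝ))}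
  add_mem' := by
    intro a b ha hb
    simpa [lp.coeFn_add, Pi.add_apply] using ha.add hb
  zero_mem' := by
    simpa [lp.coeFn_zero] using
      (tendsto_const_nhds : Filter.Tendsto (fun _ : ℕ => (0 : ℝ)) Filter.atTop (nhds 0))
  smul_mem' := by
    intro c a ha
    simpa [lp.coeFn_smul, Pi.smul_apply, smul_eq_mul] using ha.const_mul c

/-- The quotient Banach space `ℓ∞/c₀` with the quotient norm. -/
abbrev LinfQuot : Type := Linf ⧸ c0

/-- The σ-field `𝒫ⁿ(ℝ)` on `ℝⁿ` generated by products `A₁ × ⋯ × Aₙ` of arbitrary sets. -/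
def prodSigma (n : ℕ) : MeasurableSpace (Fin n → ℝ) :=
  MeasurableSpace.generateFrom {S | ∃ A : Fin n → Set ℝ, S = Set.univ.pi A}

/-- The σ-field `𝒫²(ℝ)` on `ℝ × ℝ` generated by rectangles `A × B` with `A, B ⊆ ℝ` arbitrary. -/
def P2 : MeasurableSpace (ℝ × ℝ) :=
  MeasurableSpace.generateFrom {S | ∃ A B : Set ℝ, S = A ×ˢ B}

/-- The weight of a topological space: the minimal cardinality of a base. -/
def tWeight (K : Type u) [TopologicalSpace K] : Cardinal.{u} :=
  sInf {c | ∃ B : Set (Set K), TopologicalSpace.IsTopologicalBasis B ∧ Cardinal.mk B = c}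

/-- A family of subsets of `X` is adequate if it is closed under subsets and contains every
set all of whose finite subsets belong to the family. -/
def IsAdequate {X : Type u} (A : Set (Set X)) : Prop :=
  (∀ s ∈ A, ∀ t ⊆ s, t ∈ A) ∧
  (∀ s : Set X, (∀ t ⊆ s, t.Finite → t ∈ A) → s ∈ A)

/-- `K(𝒜)`: the set of characteristic functions of members of `𝒜`, in `{0,1}^X`. -/
def KofFam {X : Type u} (A : Set (Set X)) : Set (X → Bool) :=
  {f | {x | f x = true} ∈ A}

/-- A compact space is AD-compact if it is a continuous image of an adequate compactum `K(𝒜)`. -/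
def IsADCompact (K : Type u) [TopologicalSpace K] : Prop :=
  ∃ (X : Type u) (_ : Nonempty X) (A : Set (Set X)), IsAdequate A ∧
    ∃ g : ↥(KofFam A) → K, Continuous g ∧ Function.Surjective g

/-- `E^[n]`: tuples `(x₁,…,xₙ)` of pairwise distinct reals with `(x_i, x_j) ∈ E` for `i < j`. -/
def Esec (E : Set (ℝ × ℝ)) (n : ℕ) : Set (Fin n → ℝ) :=
  {x | ∀ i j : Fin n, i < j → x i ≠ x j ∧ (x i, x j) ∈ E}

/-- The weight of a space of characteristic functions on `X` is at most the cardinality of an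
infinite index set `X`. -/
theorem tWeight_KofFam_le {X : Type u} [Infinite X] (A : Set (Set X)) :
    tWeight ↥(KofFam A) ≤ Cardinal.mk X := by
  classical
  let cyl : Finset X × Finset X → Set ↥(KofFam A) :=
    fun p => {f | (∀ x ∈ p.1, f.1 x = true) ∧ ∀ x ∈ p.2, f.1 x = false}
  have hopen (p) : IsOpen (cyl p) := by
    have hev (b : Bool) (x : X) : IsOpen {f : ↥(KofFam A) | f.1 x = b} :=
      (isOpen_discrete ({b} : Set Bool)).preimage
        ((continuous_apply x).comp continuous_subtype_val : Continuous fun f : ↥(KofFam A) => f.1 x)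
    have : cyl p = (⋂ x ∈ p.1, {f : ↥(KofFam A) | f.1 x = true}) ∩
        ⋂ x ∈ p.2, {f : ↥(KofFam A) | f.1 x = false} := by
      ext f
      simp [cyl]
    rw [this]
    exact (isOpen_biInter_finset fun x _ => hev _ x).inter
      (isOpen_biInter_finset fun x _ => hev _ x)
  have hbasis : TopologicalSpace.IsTopologicalBasis (range cyl) := by
    refine TopologicalSpace.isTopologicalBasis_of_isOpen_of_nhds ?_ ?_
    · rintro _ ⟨p, rfl⟩
      exact hopen p
    · intro f U hf hU
      obtain ⟨V, hV, rfl⟩ := isOpen_induced_iff.1 hU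
      obtain ⟨I, u, hu, hIV⟩ := isOpen_pi_iff.1 hV f.1 hf
      refine ⟨_, ⟨(I.filter fun x => f.1 x = true, I.filter fun x => f.1 x = false), rfl⟩, ?_, ?_⟩
      · simp [cyl]
      · rintro g ⟨hg₁, hg₂⟩
        refine hIV fun x hx => ?_
        have hgf : g.1 x = f.1 x := by
          cases hfx : f.1 x with
          | true => exact hg₁ x (by simpa [hfx] using hx)
          | false => exact hg₂ x (by simpa [hfx] using hx)
        exact hgf ▸ (hu x hx).2
  calc tWeight ↥(KofFam A) ≤ Cardinal.mk (range cyl) := csInf_le' ⟨_, hbasis, rfl⟩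
    _ ≤ Cardinal.mk (Finset X × Finset X) := Cardinal.mk_range_le
    _ = Cardinal.mk X := by
      rw [← Cardinal.mul_def, Cardinal.mk_finset_of_infinite,
        Cardinal.mul_eq_self (Cardinal.aleph0_le_mk X)]

/-- The space of characteristic functions of an adequate family is compact. -/
theorem IsAdequate.compactSpace_KofFam {X : Type u} {A : Set (Set X)} (hA : IsAdequate A) :
    CompactSpace ↥(KofFam A) := by
  refine isCompact_iff_compactSpace.1 (IsClosed.isCompact ?_)
  have : KofFam A = ⋂ t ∈ {t : Set X | t.Finite ∧ t ∉ A}, {f : X → Bool | ∀ x ∈ t, f x = true}ᶜ := by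
    ext f
    simp only [mem_iInter, mem_ofPred_eq, mem_compl_iff]
    constructor
    · rintro hf t ⟨-, htA⟩ ht
      exact htA (hA.1 _ hf t ht)
    · intro hf
      refine hA.2 _ fun t ht htf => ?_
      by_contra htA
      exact hf t ⟨htf, htA⟩ ht
  rw [this]
  refine isClosed_biInter fun t ht => ?_
  have : {f : X → Bool | ∀ x ∈ t, f x = true} = ⋂ x ∈ t, {f : X → Bool | f x = true} := by
    ext f
    simp
  rw [this]
  exact (ht.1.isOpen_biInter fun x _ =>
    (isOpen_discrete {true}).preimage (continuous_apply x)).isClosed_compl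

/-- The coordinate function on the space of characteristic functions, with values in `{0, 1}`. -/
def KofFam.coord {X : Type u} (A : Set (Set X)) (x : X) : C(↥(KofFam A), ℝ) where
  toFun f := if f.1 x = true then 1 else 0
  continuous_toFun :=
    (continuous_of_discreteTopology (f := fun b : Bool => if b = true then (1 : ℝ) else 0)).comp
      ((continuous_apply x).comp continuous_subtype_val)

/-- The family of subsets of `ℝ × ℕ` which are graphs of partial sequences of distinct reals that
are chains with respect to `E`. -/
def chainFam (E : Set (ℝ × ℝ)) : Set (Set (ℝ × ℕ)) :=
  {s | ∀ p ∈ s, ∀ q ∈ s, p ≠ q →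
    p.2 ≠ q.2 ∧ (p.2 < q.2 → p.1 ≠ q.1 ∧ (p.1, q.1) ∈ E)}

theorem isAdequate_chainFam (E : Set (ℝ × ℝ)) : IsAdequate (chainFam E) := by
  refine ⟨fun s hs t ht p hp q hq => hs p (ht hp) q (ht hq), fun s hs p hp q hq => ?_⟩
  exact hs {p, q} (by rintro _ (rfl | rfl) <;> assumption) (by simp) p (by simp) q (by simp)

/-- The sum of the coordinate functions associated with a finite sequence of reals. -/
def tupleSum (E : Set (ℝ × ℝ)) {n : ℕ} (x : Fin n → ℝ) : C(↥(KofFam (chainFam E)), ℝ) :=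
  ∑ i, KofFam.coord (chainFam E) (x i, (i : ℕ))

theorem tupleSum_apply (E : Set (ℝ × ℝ)) {n : ℕ} (x : Fin n → ℝ) (f : ↥(KofFam (chainFam E))) :
    tupleSum E x f = ∑ i, if f.1 (x i, (i : ℕ)) = true then (1 : ℝ) else 0 := by
  simp [tupleSum, KofFam.coord]

theorem le_norm_tupleSum (E : Set (ℝ × ℝ)) [CompactSpace ↥(KofFam (chainFam E))] {n : ℕ}
    {x : Fin n → ℝ} (hx : x ∈ Esec E n) : (n : ℝ) ≤ ‖tupleSum E x‖ := by
  classical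
  let f : ℝ × ℕ → Bool := fun p => decide (p ∈ range fun i : Fin n => (x i, (i : ℕ)))
  have hf : f ∈ KofFam (chainFam E) := by
    rintro p hp q hq hpq
    simp only [f, mem_ofPred_eq, decide_eq_true_eq] at hp hq
    obtain ⟨i, rfl⟩ := hp
    obtain ⟨j, rfl⟩ := hq
    refine ⟨fun hij => hpq ?_, fun hij => hx i j hij⟩
    rw [Fin.ext hij]
  have hval : tupleSum E x ⟨f, hf⟩ = n := by
    rw [tupleSum_apply, Finset.sum_congr rfl fun i _ => if_pos (decide_eq_true ⟨i, rfl⟩)]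
    simp
  rw [← hval]
  exact (le_abs_self _).trans ((tupleSum E x).norm_coe_le_norm _)

theorem norm_tupleSum_le (E : Set (ℝ × ℝ)) [CompactSpace ↥(KofFam (chainFam E))] {n : ℕ}
    {x : Fin n → ℝ} (hx : x ∈ Esec Eᶜ n) : ‖tupleSum E x‖ ≤ 1 := by
  refine (ContinuousMap.norm_le _ zero_le_one).2 fun f => ?_
  have hlt {i j : Fin n} (hi : f.1 (x i, (i : ℕ)) = true) (hj : f.1 (x j, (j : ℕ)) = true) :
      ¬ i < j := fun hij =>
    (hx i j hij).2 ((f.2 _ hi _ hj fun h =>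
      hij.ne (Fin.ext (congrArg Prod.snd h))).2 hij).2
  rw [tupleSum_apply, Real.norm_of_nonneg (Finset.sum_nonneg fun i _ => by split_ifs <;> simp),
    Finset.sum_boole, Nat.cast_le_one, Finset.card_le_one]
  intro i hi j hj
  rw [Finset.mem_filter] at hi hj
  exact le_antisymm (not_lt.1 (hlt hj.2 hi.2)) (not_lt.1 (hlt hi.2 hj.2))

/-- A bounded sequence that is eventually bounded by `M` has norm at most `M` modulo `c₀`. -/
theorem norm_mk_le_of_eventually {u : Linf} {M : ℝ} (hM : 0 ≤ M)
    (hu : ∀ᶠ k in atTop, |u k| ≤ M) : ‖(Submodule.Quotient.mk u : LinfQuot)‖ ≤ M := by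
  obtain ⟨N, hN⟩ := eventually_atTop.1 hu
  have hbd (k : ℕ) : ‖if N ≤ k then u k else 0‖ ≤ M := by
    split_ifs with hk
    · exact hN k hk
    · simpa using hM
  let v : Linf := ⟨fun k => if N ≤ k then u k else 0,
    memℓp_infty ⟨M, by rintro _ ⟨k, rfl⟩; exact hbd k⟩⟩
  have huv : (Submodule.Quotient.mk u : LinfQuot) = Submodule.Quotient.mk v := by
    refine (Submodule.Quotient.eq c0).2 ?_
    refine tendsto_const_nhds.congr' ?_
    filter_upwards [eventually_ge_atTop N] with k hk
    change 0 = u k - if N ≤ k then u k else 0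
    rw [if_pos hk, sub_self]
  rw [huv]
  exact (Submodule.Quotient.norm_mk_le c0 v).trans (lp.norm_le_of_forall_le hM hbd)

/-- A bounded sequence with norm less than `M` modulo `c₀` is eventually bounded by `M`. -/
theorem eventually_le_of_norm_mk_lt {u : Linf} {M : ℝ}
    (hu : ‖(Submodule.Quotient.mk u : LinfQuot)‖ < M) : ∀ᶠ k in atTop, |u k| ≤ M := by
  obtain ⟨v, hv, hvM⟩ := Submodule.Quotient.norm_mk_lt
    (Submodule.Quotient.mk u : LinfQuot) (sub_pos.2 hu)
  rw [add_sub_cancel] at hvM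
  have huv : Tendsto (fun k => (u - v) k) atTop (𝓝 0) := (Submodule.Quotient.eq c0).1 hv.symm
  filter_upwards [huv.eventually (Metric.ball_mem_nhds 0 (sub_pos.2 hvM))] with k hk
  have hvk : |v k| ≤ ‖v‖ := lp.norm_apply_le_norm ENNReal.top_ne_zero v k
  have hk' : |u k - v k| < M - ‖v‖ := by simpa using hk
  linarith [abs_sub_abs_le_abs_sub (u k) (v k)]

theorem measurable_apply_prodSigma {n : ℕ} (i : Fin n) (φ : ℝ → ℝ) :
    Measurable[prodSigma n] fun x : Fin n → ℝ => φ (x i) := by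
  classical
  intro B _
  refine MeasurableSpace.measurableSet_generateFrom ⟨fun j => if j = i then φ ⁻¹' B else univ, ?_⟩
  ext x
  simp only [mem_preimage, mem_univ_pi]
  refine ⟨fun h j => ?_, fun h => by simpa using h i⟩
  split_ifs with hj
  · exact hj ▸ h
  · trivial

/-- If for every AD-compact space of weight at most `𝔠` the space `C(K)` embeds isomorphically
into `ℓ∞/c₀`, then for every `E ⊆ ℝ²` and all but finitely many positive integers `n`, the set
`E^[n]` can be separated from `(Eᶜ)^[n]` by a member of `𝒫ⁿ(ℝ)`. -/
theorem stmt_12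
    (h : ∀ (K : Type) [TopologicalSpace K] [CompactSpace K],
      IsADCompact K → tWeight K ≤ Cardinal.continuum →
      ∃ T : C(K, ℝ) →L[ℝ] LinfQuot, Function.Injective T ∧
        ∃ c > 0, ∀ g : C(K, ℝ), c * ‖g‖ ≤ ‖T g‖) :
    ∀ E : Set (ℝ × ℝ),
      {n : ℕ | 0 < n ∧ ¬ ∃ S : Set (Fin n → ℝ), MeasurableSet[prodSigma n] S ∧
        Esec E n ⊆ S ∧ Esec Eᶜ n ∩ S = ∅}.Finite := by
  intro E
  have := (isAdequate_chainFam E).compactSpace_KofFam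
  obtain ⟨T, -, c, hc, hT⟩ := h ↥(KofFam (chainFam E))
    ⟨ℝ × ℕ, inferInstance, chainFam E, isAdequate_chainFam E, id, continuous_id,
      Function.surjective_id⟩
    ((tWeight_KofFam_le _).trans (by simp [Cardinal.mk_real]))
  refine (finite_Iic ⌊‖T‖ / c⌋₊).subset ?_
  rintro n ⟨-, hn⟩
  by_contra hlarge
  refine hn ?_
  have hTn : ‖T‖ < c * n := by
    rw [mem_Iic, not_le, Nat.floor_lt (by positivity), div_lt_iff₀ hc] at hlarge
    linarith
  obtain ⟨M, hTM, hMn⟩ := exists_between hTn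
  choose r hr using fun p : ℝ × ℕ =>
    Submodule.Quotient.mk_surjective c0 (T (KofFam.coord (chainFam E) p))
  let u : (Fin n → ℝ) → Linf := fun x => ∑ i, r (x i, (i : ℕ))
  have hu (x : Fin n → ℝ) : (Submodule.Quotient.mk (u x) : LinfQuot) = T (tupleSum E x) := by
    rw [tupleSum, map_sum, ← Submodule.mkQ_apply, map_sum]
    exact Finset.sum_congr rfl fun i _ => hr _
  have hu_apply (x : Fin n → ℝ) (k : ℕ) : u x k = ∑ i, r (x i, (i : ℕ)) k := by
    simp only [u, lp.coeFn_sum, Finset.sum_apply]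
  refine ⟨{x | ∀ᶠ k in atTop, |u x k| ≤ M}ᶜ, ?_, fun x hx hxM => ?_, ?_⟩
  · let _ := prodSigma n
    have hmeas (k : ℕ) : Measurable fun x : Fin n → ℝ => |u x k| := by
      simp only [hu_apply]
      exact (Finset.measurable_sum _ fun i _ =>
        measurable_apply_prodSigma i fun y => r (y, (i : ℕ)) k).abs
    simp only [eventually_atTop, ofPred_exists, ofPred_forall]
    exact (MeasurableSet.iUnion fun N => MeasurableSet.iInter fun k => MeasurableSet.iInter fun _ =>
      measurableSet_le (hmeas k) measurable_const).compl
  · have h₁ := norm_mk_le_of_eventually ((norm_nonneg T).trans hTM.le) hxM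
    rw [hu] at h₁
    have h₂ := mul_le_mul_of_nonneg_left (le_norm_tupleSum E hx) hc.le
    linarith [hT (tupleSum E x)]
  · refine eq_empty_of_forall_notMem fun x hx => hx.2 (eventually_le_of_norm_mk_lt ?_)
    rw [hu]
    refine lt_of_le_of_lt ?_ hTM
    simpa using T.le_opNorm_of_le (norm_tupleSum_le E hx.1)
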